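/- The number of k-divisible noncrossing partitions of {1,...,kn} equals the k-Fuss-Catalan number (1/n) * binomial((k+1)n, n−1), equivalently (1/(kn+1)) * binomial((k+1)n, n). -/

import Mathlib

/-- A set partition of `{0, …, n-1}` is noncrossing if there is no quadruple
`a < b < c < d` with `a, c` in one block and `b, d` in a different block. -/
def IsNoncrossing {n : ℕ} (P : Finpartition (Finset.univ : Finset (Fin n))) : Prop :=
  ¬ ∃ (a b c d : Fin n) (B B' : Finset (Fin n)), a < b ∧ b < c ∧ c < d ∧
      B ∈ P.parts ∧ B' ∈ P.parts ∧ B ≠ B' ∧ a ∈ B ∧ c ∈ B ∧ b ∈ B' ∧ d ∈ B'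

section NoncrossingCount

open Finset

section Greedy

variable {m : ℕ}

/-- The least element of the block of `i`. -/
def blockMin (P : Finpartition (univ : Finset (Fin m))) (i : Fin m) : Fin m :=
  (P.part i).min' (P.part_nonempty.2 (mem_univ i))

lemma part_blockMin (P : Finpartition (univ : Finset (Fin m))) (i : Fin m) :
    P.part (blockMin P i) = P.part i :=
  P.part_eq_of_mem (P.part_mem.2 (mem_univ i)) (min'_mem _ _)

lemma blockMin_eq_iff (P : Finpartition (univ : Finset (Fin m))) (i j : Fin m) :
    blockMin P i = blockMin P j ↔ P.part i = P.part j := by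
  constructor
  · intro h
    rw [← part_blockMin P i, h, part_blockMin]
  · intro h
    simp only [blockMin, h]

lemma blockMin_le_of_part_eq {P : Finpartition (univ : Finset (Fin m))} {i j : Fin m}
    (h : P.part i = P.part j) : blockMin P i ≤ j :=
  min'_le _ _ (h ▸ P.mem_part_self.2 (mem_univ j))

lemma blockMin_le (P : Finpartition (univ : Finset (Fin m))) (i : Fin m) : blockMin P i ≤ i :=
  blockMin_le_of_part_eq rfl

lemma blockMin_injective :
    Function.Injective (blockMin : Finpartition (univ : Finset (Fin m)) → Fin m → Fin m) := by
  intro P Q h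
  have hpart : ∀ i, P.part i = Q.part i := fun i ↦ by
    ext j
    rw [P.mem_part_iff_part_eq_part (mem_univ _) (mem_univ _),
      Q.mem_part_iff_part_eq_part (mem_univ _) (mem_univ _),
      ← blockMin_eq_iff, ← blockMin_eq_iff, h]
  ext B
  constructor
  · intro hB
    obtain ⟨i, hi⟩ := P.nonempty_of_mem_parts hB
    rw [← P.part_eq_of_mem hB hi, hpart]
    exact Q.part_mem.2 (mem_univ i)
  · intro hB
    obtain ⟨i, hi⟩ := Q.nonempty_of_mem_parts hB
    rw [← Q.part_eq_of_mem hB hi, ← hpart]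
    exact P.part_mem.2 (mem_univ i)

/-- `blockSize P l` is the size of the block with least element `l`, and `0` if there is none. -/
def blockSize (P : Finpartition (univ : Finset (Fin m))) (l : Fin m) : ℕ :=
  #{j | blockMin P j = l}

/-- `L` assigns to each `i` the largest label `l ≤ i` which was used fewer than `f l` times by
the elements preceding `i`. -/
def IsGreedy (f : Fin m → ℕ) (L : Fin m → Fin m) : Prop :=
  ∀ i, IsGreatest {l | l ≤ i ∧ #{j | j < i ∧ L j = l} < f l} (L i)

lemma IsGreedy.unique {f : Fin m → ℕ} {L L' : Fin m → Fin m} (h : IsGreedy f L)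
    (h' : IsGreedy f L') : L = L' := by
  funext i
  induction i using WellFoundedLT.induction with
  | ind i ih =>
    refine (h i).unique ?_
    have : ∀ l, ({j | j < i ∧ L j = l} : Finset (Fin m)) = ({j | j < i ∧ L' j = l} : Finset _) :=
      fun l ↦ by
        ext j
        simp only [mem_filter, mem_univ, true_and, and_congr_right_iff]
        intro hj
        rw [ih j hj]
    simp only [this]
    exact h' i

lemma IsGreedy.le {f : Fin m → ℕ} {L : Fin m → Fin m} (h : IsGreedy f L) (i : Fin m) : L i ≤ i :=
  (h i).1.1

lemma IsGreedy.apply_eq_self {f : Fin m → ℕ} {L : Fin m → Fin m} (h : IsGreedy f L) {l : Fin m}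
    (hl : 0 < f l) : L l = l := by
  refine le_antisymm (h.le l) ((h l).2 ⟨le_rfl, ?_⟩)
  rwa [filter_eq_empty_iff.2, card_empty]
  rintro j - ⟨hj, rfl⟩
  exact (h.le j).not_gt hj

lemma IsGreedy.idem {f : Fin m → ℕ} {L : Fin m → Fin m} (h : IsGreedy f L) (i : Fin m) :
    L (L i) = L i :=
  h.apply_eq_self ((Nat.zero_le _).trans_lt (h i).1.2)

lemma IsGreedy.card_fiber {f : Fin m → ℕ} {L : Fin m → Fin m} (h : IsGreedy f L)
    (hf : ∑ i, f i = m) (l : Fin m) : #{j | L j = l} = f l := by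
  have hle : ∀ l ∈ (univ : Finset (Fin m)), #{j | L j = l} ≤ f l := fun l _ ↦ by
    rcases ({j | L j = l} : Finset (Fin m)).eq_empty_or_nonempty with he | hne
    · simp [he]
    · set d := ({j | L j = l} : Finset (Fin m)).max' hne
      have hdl : L d = l := by simpa using max'_mem _ hne
      have hlt := (h d).1.2
      rw [hdl] at hlt
      have hsub : ({j | L j = l} : Finset (Fin m)) ⊆
          insert d ({j | j < d ∧ L j = l} : Finset (Fin m)) := by
        intro j hj
        have hjd : j ≤ d := le_max' _ _ hj
        simp only [mem_filter, mem_univ, true_and, mem_insert] at hj ⊢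
        rcases hjd.eq_or_lt with e | e
        · exact .inl e
        · exact .inr ⟨e, hj⟩
      exact (card_le_card hsub).trans ((card_insert_le _ _).trans hlt)
  have hsum : ∑ l, #{j | L j = l} = ∑ l, f l := by
    rw [hf, ← card_eq_sum_card_fiberwise (f := L) (fun _ _ ↦ by simp)]
    simp
  exact (sum_eq_sum_iff_of_le hle).1 hsum l (mem_univ l)

open Classical in
lemma exists_isGreedy {f : Fin m → ℕ} (hf : ∀ i : Fin m, (i : ℕ) + 1 ≤ ∑ j ∈ Iic i, f j) :
    ∃ L, IsGreedy f L := by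
  have key : ∀ (i : Fin m) (L : Fin m → Fin m),
      ∃ l, IsGreatest {l | l ≤ i ∧ #{j | j < i ∧ L j = l} < f l} l := by
    intro i L
    have hne : {l | l ≤ i ∧ #{j | j < i ∧ L j = l} < f l}.Nonempty := by
      by_contra! hcon
      have hle : ∀ l ∈ Iic i, f l ≤ #{j | j < i ∧ L j = l} := fun l hl ↦ by
        by_contra! hlt
        exact (Set.eq_empty_iff_forall_notMem.1 hcon l) ⟨mem_Iic.1 hl, hlt⟩
      have h1 := (hf i).trans (sum_le_sum hle)
      have h2 : ∑ l ∈ Iic i, #{j | j < i ∧ L j = l} ≤ i := by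
        calc ∑ l ∈ Iic i, #{j | j < i ∧ L j = l}
            ≤ ∑ l, #{j | j < i ∧ L j = l} := sum_le_sum_of_subset (subset_univ _)
          _ = #(Iio i) := by
            rw [card_eq_sum_card_fiberwise (f := L) (t := univ) (fun _ _ ↦ by simp)]
            refine sum_congr rfl fun l _ ↦ ?_
            congr 1
            ext j
            simp
          _ = i := by simp
      omega
    exact (Set.toFinite _).exists_maximal hne |>.imp fun l hl ↦
      ⟨hl.1, fun l' hl' ↦ (le_total l' l).elim id fun hle ↦ hl.2 hl' hle⟩
  choose g hg using key
  let L : Fin m → Fin m := WellFoundedLT.fix (motive := fun _ ↦ Fin m)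
    fun i rec ↦ g i fun j ↦ if hj : j < i then rec j hj else i
  refine ⟨L, fun i ↦ ?_⟩
  have hL : L i = g i fun j ↦ if j < i then L j else i := by
    simp only [L]
    rw [WellFoundedLT.fix_eq]
    rfl
  have := hg i fun j ↦ if j < i then L j else i
  rw [← hL] at this
  have hfilter : ∀ l, ({j | j < i ∧ (if j < i then L j else i) = l} : Finset (Fin m)) =
      ({j | j < i ∧ L j = l} : Finset _) := fun l ↦ by
    ext j
    simp only [mem_filter, mem_univ, true_and, and_congr_right_iff]
    intro hj
    rw [if_pos hj]
  simpa only [hfilter] using this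

lemma IsNoncrossing.isGreedy {P : Finpartition (univ : Finset (Fin m))} (hP : IsNoncrossing P) :
    IsGreedy (blockSize P) (blockMin P) := by
  have hself : ∀ i, i ∈ P.part i := fun i ↦ P.mem_part_self.2 (mem_univ i)
  intro i
  refine ⟨⟨blockMin_le P i, card_lt_card ?_⟩, ?_⟩
  · rw [ssubset_iff_of_subset (fun j ↦ by simp +contextual)]
    exact ⟨i, by simp⟩
  · rintro l ⟨hli, hlt⟩
    by_contra! hgt
    obtain ⟨d, hd, hdn⟩ := exists_mem_notMem_of_card_lt_card hlt
    simp only [mem_filter, mem_univ, true_and, not_and] at hd hdn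
    have hid : i ≤ d := not_lt.1 fun hdi ↦ hdn hdi hd
    have hne : i ≠ d := by
      rintro rfl
      exact hgt.ne hd
    have hPl : P.part l = P.part d := by rw [← hd, part_blockMin]
    have hne' : P.part i ≠ P.part d := fun e ↦ by
      rw [← blockMin_eq_iff, hd] at e
      exact hgt.ne e
    have hli' : l ≠ i := by
      rintro rfl
      exact hne' hPl
    refine hP ⟨blockMin P i, l, i, d, P.part i, P.part d, hgt, lt_of_le_of_ne hli hli',
      lt_of_le_of_ne hid hne, P.part_mem.2 (mem_univ _), P.part_mem.2 (mem_univ _), hne', ?_,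
      hself i, ?_, hself d⟩
    · rw [← part_blockMin P i]
      exact hself _
    · rw [← hPl]
      exact hself _

lemma blockSize_injOn :
    Set.InjOn blockSize {P : Finpartition (univ : Finset (Fin m)) | IsNoncrossing P} := by
  intro P hP Q hQ h
  have hP' := IsNoncrossing.isGreedy hP
  rw [h] at hP'
  exact blockMin_injective (hP'.unique (IsNoncrossing.isGreedy hQ))

lemma IsGreedy.isNoncrossing {P : Finpartition (univ : Finset (Fin m))} {f : Fin m → ℕ}
    (hf : ∑ i, f i = m) (h : IsGreedy f (blockMin P)) : IsNoncrossing P := by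
  rintro ⟨a, b, c, d, B, B', hab, hbc, hcd, hB, hB', hne, ha, hc, hb, hd⟩
  rw [← P.part_eq_iff_mem hB] at ha hc
  rw [← P.part_eq_iff_mem hB'] at hb hd
  have hac := (blockMin_eq_iff P a c).2 (ha.trans hc.symm)
  have hbd := (blockMin_eq_iff P b d).2 (hb.trans hd.symm)
  have hfree : ∀ {i j : Fin m}, i < j → #{x | x < i ∧ blockMin P x = blockMin P j} <
      f (blockMin P j) := fun {i j} hij ↦ by
    rw [← h.card_fiber hf]
    refine card_lt_card ?_
    rw [ssubset_iff_of_subset (fun x ↦ by simp +contextual)]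
    exact ⟨j, by simp, by simpa using hij.le⟩
  have h1 : blockMin P c ≤ blockMin P b :=
    (h b).2 ⟨hac ▸ (blockMin_le P a).trans hab.le, hfree hbc⟩
  have h2 : blockMin P d ≤ blockMin P c :=
    (h c).2 ⟨hbd ▸ (blockMin_le P b).trans hbc.le, hfree hcd⟩
  have : blockMin P b = blockMin P c := le_antisymm (hbd ▸ h2) h1
  rw [blockMin_eq_iff] at this
  exact hne (hc.symm.trans (this.symm.trans hb))

lemma sum_blockSize (P : Finpartition (univ : Finset (Fin m))) : ∑ i, blockSize P i = m := by
  simp only [blockSize]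
  rw [← card_eq_sum_card_fiberwise (f := blockMin P) (fun _ _ ↦ by simp)]
  simp

lemma succ_le_sum_blockSize (P : Finpartition (univ : Finset (Fin m))) (i : Fin m) :
    (i : ℕ) + 1 ≤ ∑ j ∈ Iic i, blockSize P j := by
  have h1 := card_eq_sum_card_fiberwise (f := blockMin P) (s := Iic i) (t := Iic i)
    (fun j hj ↦ by simpa using (blockMin_le P j).trans (by simpa using hj))
  rw [Fin.card_Iic] at h1
  rw [h1]
  refine sum_le_sum fun l _ ↦ card_le_card fun j ↦ ?_
  simp +contextual

lemma dvd_blockSize_iff (P : Finpartition (univ : Finset (Fin m))) (k : ℕ) :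
    (∀ i, k ∣ blockSize P i) ↔ ∀ B ∈ P.parts, k ∣ #B := by
  have hcard : ∀ i, blockSize P (blockMin P i) = #(P.part i) := fun i ↦ by
    rw [blockSize]
    congr 1
    ext j
    simp only [mem_filter, mem_univ, true_and, blockMin_eq_iff]
    rw [P.mem_part_iff_part_eq_part (mem_univ _) (mem_univ _)]
  constructor
  · intro h B hB
    obtain ⟨i, hi⟩ := P.nonempty_of_mem_parts hB
    rw [← P.part_eq_of_mem hB hi, ← hcard]
    exact h _
  · intro h l
    by_cases hl : ∃ i, blockMin P i = l
    · obtain ⟨i, rfl⟩ := hl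
      rw [hcard]
      exact h _ (P.part_mem.2 (mem_univ i))
    · rw [blockSize, filter_eq_empty_iff.2 (fun i _ e ↦ hl ⟨i, e⟩)]
      simp

lemma exists_blockSize_eq {f : Fin m → ℕ} (hsum : ∑ i, f i = m)
    (hf : ∀ i : Fin m, (i : ℕ) + 1 ≤ ∑ j ∈ Iic i, f j) :
    ∃ P : Finpartition (univ : Finset (Fin m)), IsNoncrossing P ∧ blockSize P = f := by
  classical
  obtain ⟨L, hL⟩ := exists_isGreedy hf
  let P : Finpartition (univ : Finset (Fin m)) := Finpartition.ofSetoid (Setoid.ker L)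
  have hmem : ∀ i j, j ∈ P.part i ↔ L i = L j := fun i j ↦ by
    simp only [P, Finpartition.mem_part_ofSetoid_iff_rel, Setoid.ker_def]
  have hP : blockMin P = L := by
    funext i
    refine le_antisymm (min'_le _ _ ((hmem _ _).2 (hL.idem i).symm)) (le_min' _ _ _ fun j hj ↦ ?_)
    rw [(hmem _ _).1 hj]
    exact hL.le j
  rw [← hP] at hL
  exact ⟨P, hL.isNoncrossing hsum, funext fun l ↦ hL.card_fiber hsum l⟩

lemma image_blockSize (k : ℕ) :
    blockSize '' {P : Finpartition (univ : Finset (Fin m)) |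
        IsNoncrossing P ∧ ∀ B ∈ P.parts, k ∣ #B} =
      {f : Fin m → ℕ | (∑ i, f i = m ∧ ∀ i : Fin m, (i : ℕ) + 1 ≤ ∑ j ∈ Iic i, f j) ∧
        ∀ i, k ∣ f i} := by
  ext f
  constructor
  · rintro ⟨P, ⟨-, hk⟩, rfl⟩
    exact ⟨⟨sum_blockSize P, succ_le_sum_blockSize P⟩, (dvd_blockSize_iff P k).2 hk⟩
  · rintro ⟨⟨hsum, hf⟩, hk⟩
    obtain ⟨P, hP, rfl⟩ := exists_blockSize_eq hsum hf
    exact ⟨P, ⟨hP, (dvd_blockSize_iff P k).1 hk⟩, rfl⟩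

end Greedy

section CycleLemma

variable {m : ℕ}

/-- The partial sums of `k * x` satisfy `j ≤ k * (x 0 + ⋯ + x (j - 1))` for all `j ≤ m`. -/
def IsBallot (k : ℕ) (x : Fin (m + 1) → ℕ) : Prop :=
  ∀ j ≤ m, j ≤ k * ∑ i ∈ range j, x (Fin.ofNat (m + 1) i)

/-- The height after `j` steps of the periodic lattice path with steps `k * x i - 1`. -/
def height (k : ℕ) (x : Fin (m + 1) → ℕ) (j : ℕ) : ℤ :=
  ∑ i ∈ range j, ((k * x (Fin.ofNat (m + 1) i) : ℤ) - 1)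

lemma height_add_period {k n : ℕ} (hm : k * n = m) {x : Fin (m + 1) → ℕ} (hx : ∑ i, x i = n)
    (j : ℕ) : height k x (m + 1 + j) = height k x j - 1 := by
  have h1 : ∑ i ∈ range (m + 1), ((k * x (Fin.ofNat (m + 1) i) : ℤ) - 1) = -1 := by
    rw [← Fin.sum_univ_eq_sum_range (fun i ↦ ((k * x (Fin.ofNat (m + 1) i) : ℤ) - 1))]
    simp only [Fin.ofNat_val_eq_self, sum_sub_distrib, ← mul_sum]
    have : (∑ i, (x i : ℤ)) = n := by exact_mod_cast hx
    rw [this]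
    have : (k * n : ℤ) = m := by exact_mod_cast hm
    simp [this]
  have h2 : ∀ i, Fin.ofNat (m + 1) (m + 1 + i) = Fin.ofNat (m + 1) i := fun i ↦ by
    ext
    simp
  rw [height, sum_range_add, h1]
  simp only [h2, height]
  ring

lemma isBallot_rotate_iff (k : ℕ) (x : Fin (m + 1) → ℕ) (r : Fin (m + 1)) :
    IsBallot k (fun i ↦ x (i + r)) ↔ ∀ j ≤ m, height k x r ≤ height k x (r + j) := by
  refine forall₂_congr fun j _ ↦ ?_
  have h : ∀ i, Fin.ofNat (m + 1) (r + i) = Fin.ofNat (m + 1) i + r := fun i ↦ by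
    ext
    simp [Fin.val_add, add_comm]
  rw [height, height, sum_range_add]
  simp only [h, sum_sub_distrib, ← mul_sum]
  simp only [sum_const, card_range, nsmul_eq_mul, mul_one]
  rw [← Nat.cast_le (α := ℤ)]
  push_cast
  constructor <;> intro <;> linarith

lemma existsUnique_isBallot_rotate {k n : ℕ} (hm : k * n = m) {x : Fin (m + 1) → ℕ}
    (hx : ∑ i, x i = n) : ∃! r : Fin (m + 1), IsBallot k (fun i ↦ x (i + r)) := by
  simp only [isBallot_rotate_iff]
  have hper := height_add_period hm hx
  obtain ⟨r₀, -, hr₀⟩ := exists_min_image univ (fun r : Fin (m + 1) ↦ height k x r) univ_nonempty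
  have hne : ({r : Fin (m + 1) | height k x r = height k x r₀} : Finset _).Nonempty := ⟨r₀, by simp⟩
  set r := ({r : Fin (m + 1) | height k x r = height k x r₀} : Finset _).min' hne
  have hrr : height k x r = height k x r₀ := by simpa using min'_mem _ hne
  have hmin : ∀ s : Fin (m + 1), height k x r ≤ height k x s := fun s ↦ hrr ▸ hr₀ s (mem_univ s)
  have hlt : ∀ s < r, height k x r < height k x s := fun s hs ↦
    lt_of_le_of_ne (hmin s) fun e ↦ (min'_le _ s (by simp [← e, hrr])).not_gt hs
  refine ⟨r, fun j hj ↦ ?_, fun s hs ↦ ?_⟩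
  · by_cases h : r + j < m + 1
    · exact hmin ⟨r + j, h⟩
    · obtain ⟨t, ht⟩ := Nat.exists_eq_add_of_le (not_lt.1 h)
      have htr : t < r := by omega
      have := hlt ⟨t, htr.trans r.2⟩ htr
      rw [ht, hper]
      simp only at this
      omega
  · rcases lt_trichotomy s r with h | h | h
    · have h1 := hs (r - s) (by omega)
      rw [Nat.add_sub_cancel' (Fin.le_def.1 h.le)] at h1
      exact absurd (hlt s h) h1.not_gt
    · exact h
    · have h1 := hs (m + 1 + r - s) (by omega)
      rw [show (s : ℕ) + (m + 1 + r - s) = m + 1 + r by omega, hper] at h1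
      have := hmin s
      omega

open Classical in
lemma ncard_isBallot {k n : ℕ} (hm : k * n = m) :
    {x : Fin (m + 1) → ℕ | ∑ i, x i = n ∧ IsBallot k x}.ncard * (m + 1) = (n + m).choose n := by
  let X : Finset (Fin (m + 1) → ℕ) := piAntidiag univ n
  have hX : ∀ x, x ∈ X ↔ ∑ i, x i = n := fun x ↦ by simp [X]
  have hcard : #X = (n + m).choose n := by
    rw [show X = _ from (map_sym_eq_piAntidiag univ n).symm, card_map, sym_univ, card_univ,
      Sym.card_sym_eq_choose]
    congr 1
    simp
    omega
  have hG : {x : Fin (m + 1) → ℕ | ∑ i, x i = n ∧ IsBallot k x}.ncard = #{x ∈ X | IsBallot k x} := by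
    rw [← Set.ncard_coe_finset]
    congr 1
    ext x
    simp [hX]
  have h := sum_card_bipartiteAbove_eq_sum_card_bipartiteBelow (s := X)
    (t := (univ : Finset (Fin (m + 1)))) (fun x r ↦ IsBallot k (fun i ↦ x (i + r)))
  have h1 : ∀ x ∈ X, #(univ.bipartiteAbove (fun x r ↦ IsBallot k (fun i ↦ x (i + r))) x) = 1 :=
    fun x hx ↦ by
      obtain ⟨r, hr, hu⟩ := existsUnique_isBallot_rotate hm ((hX x).1 hx)
      refine card_eq_one.2 ⟨r, ?_⟩
      ext s
      simp only [mem_bipartiteAbove, mem_univ, true_and, mem_singleton]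
      exact ⟨hu s, fun e ↦ e ▸ hr⟩
  have h2 : ∀ r : Fin (m + 1),
      #(X.bipartiteBelow (fun x r ↦ IsBallot k (fun i ↦ x (i + r))) r) =
        #{x ∈ X | IsBallot k x} := fun r ↦ by
    refine card_equiv ((Equiv.addRight r).symm.arrowCongr (Equiv.refl ℕ)) fun x ↦ ?_
    have : ∑ i, x (i + r) = ∑ i, x i := Equiv.sum_comp (Equiv.addRight r) x
    have he : ((Equiv.addRight r).symm.arrowCongr (Equiv.refl ℕ)) x = fun i ↦ x (i + r) := rfl
    rw [he]
    simp [hX, this]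
  rw [sum_congr rfl h1, sum_congr rfl (fun r _ ↦ h2 r)] at h
  simp only [sum_const, card_univ, Fintype.card_fin, smul_eq_mul, mul_one] at h
  rw [hG, ← hcard, h, mul_comm]

lemma sum_range_ofNat_eq_sum_Iic (x : Fin (m + 1) → ℕ) (i : Fin m) :
    ∑ j ∈ range (i + 1), x (Fin.ofNat (m + 1) j) = ∑ j ∈ Iic i, x j.castSucc := by
  symm
  refine sum_bij (fun j _ ↦ (j : ℕ)) (fun j hj ↦ ?_) (fun _ _ _ _ e ↦ Fin.ext e) (fun j hj ↦ ?_)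
    (fun j _ ↦ ?_)
  · have : j ≤ i := by simpa using hj
    simp only [mem_range]
    omega
  · have : j < i + 1 := by simpa using hj
    exact ⟨⟨j, by omega⟩, by simp [Fin.le_def]; omega, rfl⟩
  · congr 1
    ext
    simp

lemma isBallot_iff (k : ℕ) (x : Fin (m + 1) → ℕ) :
    IsBallot k x ↔ ∀ i : Fin m, (i : ℕ) + 1 ≤ ∑ j ∈ Iic i, k * x j.castSucc := by
  simp only [← mul_sum, ← sum_range_ofNat_eq_sum_Iic]
  constructor
  · exact fun h i ↦ h _ (by omega)
  · rintro h (_ | j) hj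
    · simp
    · exact h ⟨j, by omega⟩

lemma IsBallot.le_mul_sum {k : ℕ} {x : Fin (m + 1) → ℕ} (h : IsBallot k x) :
    m ≤ k * ∑ i : Fin m, x i.castSucc := by
  refine (h m le_rfl).trans_eq ?_
  rw [← Fin.sum_univ_eq_sum_range (fun i ↦ x (Fin.ofNat (m + 1) i))]
  congr 1
  refine sum_congr rfl fun i _ ↦ congrArg x ?_
  ext
  simp

lemma IsBallot.last_eq_zero {k n : ℕ} (hk : 0 < k) (hm : k * n = m) {x : Fin (m + 1) → ℕ}
    (hx : ∑ i, x i = n) (h : IsBallot k x) : x (Fin.last m) = 0 := by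
  have h1 := h.le_mul_sum
  rw [Fin.sum_univ_castSucc] at hx
  have h2 : n ≤ ∑ i : Fin m, x i.castSucc := Nat.le_of_mul_le_mul_left (hm.trans_le h1) hk
  omega

lemma bijOn_isBallot {k n : ℕ} (hk : 0 < k) (hm : k * n = m) :
    Set.BijOn (fun (x : Fin (m + 1) → ℕ) (i : Fin m) ↦ k * x i.castSucc)
      {x | ∑ i, x i = n ∧ IsBallot k x}
      {f : Fin m → ℕ | (∑ i, f i = m ∧ ∀ i : Fin m, (i : ℕ) + 1 ≤ ∑ j ∈ Iic i, f j) ∧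
        ∀ i, k ∣ f i} := by
  refine ⟨?_, ?_, ?_⟩
  · rintro x ⟨hx, hb⟩
    refine ⟨⟨?_, (isBallot_iff k x).1 hb⟩, fun i ↦ dvd_mul_right _ _⟩
    have h0 := hb.last_eq_zero hk hm hx
    rw [Fin.sum_univ_castSucc, h0, add_zero] at hx
    rw [← mul_sum, hx, hm]
  · rintro x ⟨hx, hxb⟩ y ⟨hy, hyb⟩ h
    funext i
    refine Fin.lastCases ?_ (fun i ↦ ?_) i
    · rw [hxb.last_eq_zero hk hm hx, hyb.last_eq_zero hk hm hy]
    · exact Nat.eq_of_mul_eq_mul_left hk (congrFun h i)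
  · rintro f ⟨⟨hsum, hf⟩, hdvd⟩
    choose g hg using hdvd
    obtain rfl : f = fun i ↦ k * g i := funext hg
    refine ⟨Fin.snoc (α := fun _ ↦ ℕ) g 0, ⟨?_, ?_⟩, ?_⟩
    · rw [Fin.sum_univ_castSucc]
      simp only [Fin.snoc_castSucc, Fin.snoc_last, add_zero]
      rw [← mul_sum] at hsum
      exact Nat.eq_of_mul_eq_mul_left hk (hsum.trans hm.symm)
    · rw [isBallot_iff]
      simpa only [Fin.snoc_castSucc] using hf
    · funext i
      simp

end CycleLemma

lemma ncard_noncrossing_mul {m k n : ℕ} (hk : 0 < k) (hm : k * n = m) :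
    {P : Finpartition (univ : Finset (Fin m)) |
        IsNoncrossing P ∧ ∀ B ∈ P.parts, k ∣ #B}.ncard * (m + 1) = (n + m).choose n := by
  rw [← ncard_isBallot hm, ← (bijOn_isBallot hk hm).injOn.ncard_image,
    (bijOn_isBallot hk hm).image_eq, ← image_blockSize,
    (blockSize_injOn.mono fun _ h ↦ h.1).ncard_image]

end NoncrossingCount

/-- The number of `k`-divisible noncrossing partitions of `{1, …, kn}` is the
`k`-Fuss–Catalan number `(1/(kn+1)) * C((k+1)n, n)`. -/
theorem stmt_11 (k n : ℕ) (hk : 0 < k) :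
    {P : Finpartition (Finset.univ : Finset (Fin (k * n))) |
        IsNoncrossing P ∧ ∀ B ∈ P.parts, k ∣ B.card}.ncard =
      Nat.choose ((k + 1) * n) n / (k * n + 1) := by
  rw [show (k + 1) * n = n + k * n by ring, ← ncard_noncrossing_mul hk rfl,
    Nat.mul_div_cancel _ (Nat.succ_pos _)]
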